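/- Assume Y is a finite set (with the discrete topology, so that F = ℝ̄^Y). Let g ∈ G. Then the equation Bf = g has a unique solution f ∈ F if, and only if, {(∂°g)⁻¹(y)}_{y∈ldom(B°g)} is an algebraically minimal covering of udom g. -/

import Mathlib

noncomputable def Bop {X Y : Type*} (b : X → Y → EReal → EReal) (f : Y → EReal) : X → EReal :=
  fun x => ⨆ y, b x y (f y)

noncomputable def Bgal {X Y : Type*} (bo : Y → X → EReal → EReal) (g : X → EReal) : Y → EReal :=
  fun y => ⨆ x, bo y x (g x)

/-- Subdifferential of `f` at `y` with respect to the kernel `b`. -/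
def subdiff {X Y : Type*} (b : X → Y → EReal → EReal) (S : Set (X × Y))
    (f : Y → EReal) (y : Y) : Set X :=
  {x | (x, y) ∈ S ∧ Bop b f x = b x y (f y)}

/-- Subdifferential of `g` at `x` with respect to the kernel `b°`. -/
def subdiffo {X Y : Type*} (bo : Y → X → EReal → EReal) (S : Set (X × Y))
    (g : X → EReal) (x : X) : Set Y :=
  {y | (x, y) ∈ S ∧ Bgal bo g y = bo y x (g x)}

/-- `(∂°g)⁻¹(y)`. -/
def subdiffoInv {X Y : Type*} (bo : Y → X → EReal → EReal) (S : Set (X × Y))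
    (g : X → EReal) (y : Y) : Set X :=
  {x | y ∈ subdiffo bo S g x}

def ldom {Z : Type*} (h : Z → EReal) : Set Z := {z | h z < ⊤}
def udom {Z : Type*} (h : Z → EReal) : Set Z := {z | ⊥ < h z}
def edom {Z : Type*} (h : Z → EReal) : Set Z := ldom h ∩ udom h
def idom {Z : Type*} [TopologicalSpace Z] (h : Z → EReal) : Set Z :=
  {z | z ∈ edom h ∧ Filter.limsup h (nhds z) < ⊤}

/-- `b` is continuous in the second variable. -/
def Cont2 {X Y : Type*} [TopologicalSpace Y] (b : X → Y → EReal → EReal) : Prop :=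
  ∀ (x : X) (α : ℝ), Continuous fun y => b x y (α : EReal)

/-- `b` is coercive. -/
def Coercive {X Y : Type*} [TopologicalSpace X] [TopologicalSpace Y]
    (b : X → Y → EReal → EReal) (bo : Y → X → EReal → EReal) : Prop :=
  ∀ x : X, ∀ V ∈ nhds x, ∀ (α β : ℝ),
    IsCompact (closure {y : Y | (⨆ z ∈ V, b z y (bo y x (α : EReal))) ≤ (β : EReal)})

/-- `f ∈ F_c`: relatively compact finite superlevel sets. -/
def MemFc {X Y : Type*} [TopologicalSpace Y] (b : X → Y → EReal → EReal)
    (f : Y → EReal) : Prop :=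
  ∀ (x : X) (β : ℝ), IsCompact (closure {y : Y | (β : EReal) ≤ b x y (f y)})

/-- `f` solves Problem (P') for the data `g`, `X'`. -/
def IsSolution {X Y : Type*} [TopologicalSpace Y] (b : X → Y → EReal → EReal)
    (g : X → EReal) (X' : Set X) (f : Y → EReal) : Prop :=
  LowerSemicontinuous f ∧ (∀ x, Bop b f x ≤ g x) ∧ ∀ x ∈ X', Bop b f x = g x

def SemiOpen {Z : Type*} [TopologicalSpace Z] (s : Set Z) : Prop :=
  s ⊆ closure (interior s)

def QuasiContinuous {Z W : Type*} [TopologicalSpace Z] [TopologicalSpace W]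
    (h : Z → W) : Prop :=
  ∀ G : Set W, IsOpen G → SemiOpen (h ⁻¹' G)

/-- `h` is quasi-continuous on its domain. -/
def QuasiContinuousOnDom {Z : Type*} [TopologicalSpace Z] (h : Z → EReal) : Prop :=
  QuasiContinuous fun z : edom h => h z.1

/-- `y` is algebraically essential with respect to the covering of `W'` by `{Fm z}_{z ∈ Z'}`. -/
def AlgEssential {Z W : Type*} (Fm : Z → Set W) (Z' : Set Z) (W' : Set W) (y : Z) : Prop :=
  y ∈ Z' ∧ ∃ w ∈ W', ∀ z ∈ Z' \ {y}, w ∉ Fm z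

/-- `y` is topologically essential with respect to the covering of `W'` by `{Fm z}_{z ∈ Z'}`. -/
def TopEssential {Z W : Type*} [TopologicalSpace Z] (Fm : Z → Set W) (Z' : Set Z)
    (W' : Set W) (y : Z) : Prop :=
  y ∈ Z' ∧ ∀ U : Set Z, IsOpen U → y ∈ U → ∃ w ∈ W', ∀ z ∈ Z' \ U, w ∉ Fm z

section GaloisKernel

variable {X Y : Type*} {b : X → Y → EReal → EReal} {bo : Y → X → EReal → EReal}
  {S : Set (X × Y)}

theorem Bop_le_iff_Bgal_le
    (hgal : ∀ (x : X) (y : Y) (α β : EReal), b x y α ≤ β ↔ bo y x β ≤ α)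
    (f : Y → EReal) (g : X → EReal) : Bop b f ≤ g ↔ Bgal bo g ≤ f := by
  simp only [Pi.le_def, Bop, Bgal, iSup_le_iff, hgal]
  exact forall_comm

theorem kernel_top
    (hgal : ∀ (x : X) (y : Y) (α β : EReal), b x y α ≤ β ↔ bo y x β ≤ α)
    (x : X) (y : Y) : b x y ⊤ = ⊥ :=
  le_bot_iff.1 ((hgal x y ⊤ ⊥).2 le_top)

theorem kernel_conj_of_surjective
    (hgal : ∀ (x : X) (y : Y) (α β : EReal), b x y α ≤ β ↔ bo y x β ≤ α)
    {x : X} {y : Y} (hsurj : Function.Surjective (b x y)) (β : EReal) :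
    b x y (bo y x β) = β := by
  obtain ⟨α, rfl⟩ := hsurj β
  refine le_antisymm ((hgal _ _ _ _).2 le_rfl) ?_
  have hle : bo y x (b x y α) ≤ α := (hgal _ _ _ _).1 le_rfl
  exact (hgal _ _ _ _).2 (((hgal _ _ _ _).1 le_rfl).trans hle)

/-- Over a finite `Y`, the solutions of `Bf = g` are the `f ≥ B°g` such that every point of
`udom g` lies in some `(∂°g)⁻¹(y)` with `f y = B°g y < ⊤`. -/
theorem Bop_eq_iff [Finite Y]
    (hgal : ∀ (x : X) (y : Y) (α β : EReal), b x y α ≤ β ↔ bo y x β ≤ α)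
    (hS1 : ∀ x : X, ∃ y : Y, (x, y) ∈ S)
    (hS3 : ∀ x y, (x, y) ∈ S → Function.Bijective (b x y))
    (hS4 : ∀ x y, (x, y) ∉ S → ∀ α : EReal, b x y α = ⊥)
    (f : Y → EReal) (g : X → EReal) :
    Bop b f = g ↔ Bgal bo g ≤ f ∧
      ∀ x ∈ udom g, ∃ y ∈ ldom (Bgal bo g), f y = Bgal bo g y ∧ x ∈ subdiffoInv bo S g y := by
  constructor
  · intro h
    have hle : Bgal bo g ≤ f := (Bop_le_iff_Bgal_le hgal f g).1 h.le
    refine ⟨hle, fun x hx => ?_⟩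
    have : Nonempty Y := (hS1 x).nonempty
    obtain ⟨y, hy⟩ := exists_eq_ciSup_of_finite (f := fun y => b x y (f y))
    have hy : b x y (f y) = g x := hy.trans (congrFun h x)
    have hne : b x y (f y) ≠ ⊥ := hy ▸ (show ⊥ < g x from hx).ne'
    have hxy : (x, y) ∈ S := by
      by_contra hn
      exact hne (hS4 x y hn _)
    have hfy : f y = bo y x (g x) := (hS3 x y hxy).1
      (hy.trans (kernel_conj_of_surjective hgal (hS3 x y hxy).2 _).symm)
    have heq : f y = Bgal bo g y :=
      le_antisymm (hfy.trans_le (le_iSup (fun x => bo y x (g x)) x)) (hle y)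
    refine ⟨y, lt_top_iff_ne_top (a := Bgal bo g y).2 fun htop => hne ?_, heq, hxy, heq.symm.trans hfy⟩
    rw [heq, htop, kernel_top hgal]
  · rintro ⟨hle, hcov⟩
    refine le_antisymm ((Bop_le_iff_Bgal_le hgal f g).2 hle) fun x => ?_
    rcases eq_bot_or_bot_lt (g x) with hx | hx
    · exact hx ▸ bot_le
    · obtain ⟨y, -, hfy, hxy, hsub⟩ := hcov x hx
      calc g x = b x y (f y) := by
            rw [hfy, hsub, kernel_conj_of_surjective hgal (hS3 x y hxy).2]
        _ ≤ Bop b f x := le_iSup (fun y => b x y (f y)) y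

end GaloisKernel

/-- For finite `Y`, `Bf = g` has a unique solution iff
`{(∂°g)⁻¹(y)}_{y ∈ ldom(B°g)}` is an algebraically minimal covering of `udom g`. -/
theorem stmt15
    {X Y : Type*} [TopologicalSpace X] [TopologicalSpace Y] [T2Space X] [T2Space Y]
    (b : X → Y → EReal → EReal) (bo : Y → X → EReal → EReal) (S : Set (X × Y))
    (hgal : ∀ (x : X) (y : Y) (α β : EReal), b x y α ≤ β ↔ bo y x β ≤ α)
    (hbo_lsc : ∀ (x : X) (α : EReal), LowerSemicontinuous fun y => bo y x α)
    (hS1 : ∀ x : X, ∃ y : Y, (x, y) ∈ S)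
    (hS2 : ∀ y : Y, ∃ x : X, (x, y) ∈ S)
    (hS3 : ∀ x y, (x, y) ∈ S → Function.Bijective (b x y))
    (hS4 : ∀ x y, (x, y) ∉ S → ∀ α : EReal, b x y α = ⊥)
    [Finite Y] [DiscreteTopology Y]
    (g : X → EReal) :
    (∃! f : Y → EReal, LowerSemicontinuous f ∧ Bop b f = g) ↔
      ((udom g ⊆ ⋃ y ∈ ldom (Bgal bo g), subdiffoInv bo S g y) ∧
        ∀ y ∈ ldom (Bgal bo g),
          AlgEssential (subdiffoInv bo S g) (ldom (Bgal bo g)) (udom g) y) := by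
  have hlsc (f : Y → EReal) : LowerSemicontinuous f :=
    continuous_of_discreteTopology.lowerSemicontinuous
  simp only [hlsc, true_and, Bop_eq_iff hgal hS1 hS3 hS4]
  constructor
  · rintro ⟨f, ⟨hle, hcov⟩, huniq⟩
    refine ⟨fun x hx => ?_, fun y₀ hy₀ => ⟨hy₀, ?_⟩⟩
    · obtain ⟨y, hy, -, hxy⟩ := hcov x hx
      exact Set.mem_biUnion hy hxy
    · classical
      by_contra! hess
      have hmin := huniq (Bgal bo g) ⟨le_rfl, fun x hx => by
        obtain ⟨y, hy, -, hxy⟩ := hcov x hx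
        exact ⟨y, hy, rfl, hxy⟩⟩
      have hupd := huniq (Function.update (Bgal bo g) y₀ ⊤)
        ⟨le_update_self_iff.2 le_top, fun x hx => by
          obtain ⟨y, ⟨hy, hne⟩, hxy⟩ := hess x hx
          exact ⟨y, hy, Function.update_of_ne hne _ _, hxy⟩⟩
      have htop := congrFun (hmin.trans hupd.symm) y₀
      rw [Function.update_self] at htop
      exact (show Bgal bo g y₀ < ⊤ from hy₀).ne htop
  · rintro ⟨hcov, hess⟩
    refine ⟨Bgal bo g, ⟨le_rfl, fun x hx => ?_⟩, fun f ⟨hle, hf⟩ => ?_⟩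
    · obtain ⟨y, hy, hxy⟩ := Set.mem_iUnion₂.1 (hcov hx)
      exact ⟨y, hy, rfl, hxy⟩
    · refine le_antisymm (fun y₀ => ?_) hle
      by_cases hy₀ : y₀ ∈ ldom (Bgal bo g)
      · obtain ⟨-, w, hw, hout⟩ := hess y₀ hy₀
        obtain ⟨y, hy, heq, hwy⟩ := hf w hw
        by_cases hyy : y = y₀
        · exact hyy ▸ heq.le
        · exact absurd hwy (hout y ⟨hy, hyy⟩)
      · exact le_top.trans (not_lt.1 hy₀)
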